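/- Let q = p^f > 2 be a prime power and let N be the number of permutations σ of 𝔽_q with deg(f_σ) < q−2. Then |N − (q−1)!| ≤ ((q−1)/(2q(q−1)^{(q−1)/2})) · ∑_{S ⊆ 𝔽_q} |q − 2|S|| · ((q − |S|)·|S|)^{(q−1)/2}. -/

import Mathlib

open Finset Polynomial

/-- The permutation polynomial of a permutation `σ` of a finite field:
`f_σ(x) = ∑_{c} σ(c) (1 - (x - c)^(q-1))`. -/
noncomputable def permPoly {F : Type*} [Field F] [Fintype F] (σ : Equiv.Perm F) : Polynomial F :=
  ∑ c : F, Polynomial.C (σ c) * (1 - (Polynomial.X - Polynomial.C c) ^ (Fintype.card F - 1))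


theorem degree_iff {F : Type*} [Field F] [Fintype F] (h2 : 2 < Fintype.card F)
    (σ : Equiv.Perm F) :
    (permPoly σ).degree < ((Fintype.card F - 2 : ℕ) : WithBot ℕ) ↔ ∑ c : F, c * σ c = 0 := by
  classical
  obtain ⟨n, hn⟩ : ∃ n, Fintype.card F = n + 3 := ⟨Fintype.card F - 3, by omega⟩
  have hcast : ((n : F) + 1 + 1) = -1 := by
    have : ((n + 3 : ℕ) : F) = 0 := by rw [← hn]; exact FiniteField.cast_card_eq_zero F
    push_cast at this
    linear_combination this
  have hcoeff : ∀ m, 1 ≤ m → (permPoly σ).coeff m =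
      ∑ c : F, σ c * (-((-c) ^ (n + 2 - m) * ((n + 2).choose m : F))) := by
    intro m hm
    unfold permPoly
    rw [Polynomial.finsetSum_coeff]
    refine Finset.sum_congr rfl fun c _ => ?_
    rw [Polynomial.coeff_C_mul, Polynomial.coeff_sub, hn, show n + 3 - 1 = n + 2 by omega,
      sub_eq_add_neg X, ← Polynomial.C_neg, Polynomial.coeff_X_add_C_pow, Polynomial.coeff_one, if_neg (by omega), zero_sub]
  have hmid : (permPoly σ).coeff (n + 1) = - ∑ c : F, c * σ c := by
    rw [hcoeff _ (by omega), ← Finset.sum_neg_distrib]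
    refine Finset.sum_congr rfl fun c _ => ?_
    rw [show n + 2 - (n + 1) = 1 by omega, Nat.choose_succ_self_right]
    push_cast
    rw [hcast]; ring
  have htop : (permPoly σ).coeff (n + 2) = 0 := by
    rw [hcoeff _ (by omega)]
    simp only [Nat.sub_self, pow_zero, Nat.choose_self, Nat.cast_one, mul_neg, mul_one]
    rw [Finset.sum_neg_distrib, Equiv.sum_comp σ (fun x => x)]
    have := FiniteField.sum_pow_lt_card_sub_one F 1 (by omega)
    simpa using this
  rw [Polynomial.degree_lt_iff_coeff_zero, hn]
  constructor
  · intro h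
    have := h (n + 1) (by omega)
    rw [hmid] at this
    simpa using this
  · intro h m hm
    rcases (by omega : m = n + 1 ∨ m = n + 2 ∨ n + 2 < m) with rfl | rfl | h3
    · rw [hmid, h, neg_zero]
    · exact htop
    · rw [hcoeff _ (by omega), Nat.choose_eq_zero_of_lt h3]
      simp

theorem ryser {F : Type*} [Fintype F] [DecidableEq F] (A : F → F → ℂ) :
    ∑ σ : Equiv.Perm F, ∏ c, A c (σ c) =
      (-1) ^ (Fintype.card F) * ∑ S : Finset F, (-1) ^ S.card * ∏ c, ∑ t ∈ S, A c t := by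
  have h1 : ∀ f : F → F, ∑ S : Finset F, (if ∀ c, f c ∈ S then (-1 : ℂ) ^ S.card else 0) =
      if Function.Surjective f then (-1) ^ (Fintype.card F) else 0 := by
    intro f
    have key := Finset.prod_add (fun _ : F => (-1 : ℂ))
      (fun t => if ∃ c, f c = t then 0 else 1) Finset.univ
    rw [Finset.powerset_univ] at key
    have e1 : ∀ S : Finset F, (if ∀ c, f c ∈ S then (-1 : ℂ) ^ S.card else 0) =
        (∏ _t ∈ S, (-1 : ℂ)) * ∏ t ∈ univ \ S, (if ∃ c, f c = t then 0 else 1) := by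
      intro S
      rw [Finset.prod_const]
      split_ifs with h
      · rw [Finset.prod_eq_one, mul_one]
        intro t ht
        rw [if_neg]
        rintro ⟨c, rfl⟩
        simp [h c] at ht
      · push Not at h
        obtain ⟨c, hc⟩ := h
        rw [Finset.prod_eq_zero (i := f c), mul_zero]
        · simp [hc]
        · simp
    rw [Finset.sum_congr rfl (fun S _ => e1 S), ← key]
    split_ifs with h
    · rw [Finset.prod_congr rfl (g := fun _ => (-1 : ℂ)), Finset.prod_const, Finset.card_univ]
      intro t _
      rw [if_pos (h t), add_zero]
    · unfold Function.Surjective at h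
      push Not at h
      obtain ⟨t, ht⟩ := h
      apply Finset.prod_eq_zero (Finset.mem_univ t)
      rw [if_neg (by simpa using ht)]
      ring
  have h2 : ∑ S : Finset F, (-1) ^ S.card * ∏ c, ∑ t ∈ S, A c t =
      ∑ f : F → F, (if Function.Surjective f then (-1) ^ (Fintype.card F) else 0) *
        ∏ c, A c (f c) := by
    simp_rw [← h1, Finset.sum_mul]
    rw [Finset.sum_comm]
    refine Finset.sum_congr rfl fun S _ => ?_
    rw [Finset.prod_univ_sum, Finset.mul_sum]
    simp_rw [ite_mul, zero_mul]
    rw [← Finset.sum_filter]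
    refine Finset.sum_congr ?_ fun _ _ => rfl
    ext f
    simp [Fintype.mem_piFinset]
  rw [h2]
  simp_rw [ite_mul, zero_mul]
  rw [← Finset.sum_filter, ← Finset.mul_sum, ← mul_assoc, ← mul_pow]
  simp only [mul_neg, mul_one, neg_neg, one_pow, one_mul]
  refine Finset.sum_bij (fun σ _ => (σ : F → F)) ?_ ?_ ?_ ?_
  · intro σ _
    simp [σ.surjective]
  · intro σ _ τ _ h
    exact Equiv.coe_fn_injective h
  · intro f hf
    have hf' : Function.Surjective f := by simpa using hf
    exact ⟨Equiv.ofBijective f (Finite.surjective_iff_bijective.1 hf'), Finset.mem_univ _, rfl⟩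
  · intros; rfl

theorem sum_normSq_eq {F : Type*} [Field F] [Fintype F] [DecidableEq F] (φ : AddChar F ℂ)
    (hφ : ∀ b, ∑ x, φ (x * b) = if b = 0 then (Fintype.card F : ℂ) else 0) (S : Finset F) :
    ∑ c, ‖∑ t ∈ S, φ (c * t)‖ ^ 2 = (Fintype.card F : ℝ) * S.card := by
  have : (∑ c, ((‖∑ t ∈ S, φ (c * t)‖ ^ 2 : ℝ) : ℂ)) = (Fintype.card F : ℂ) * S.card := by
    calc _ = ∑ c, ∑ t ∈ S, ∑ s ∈ S, φ (c * (t - s)) := by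
          refine Finset.sum_congr rfl fun c _ => ?_
          rw [Complex.ofReal_pow, ← Complex.mul_conj', map_sum, Finset.sum_mul_sum]
          refine Finset.sum_congr rfl fun t _ => Finset.sum_congr rfl fun s _ => ?_
          rw [← AddChar.map_neg_eq_conj, ← AddChar.map_add_eq_mul]
          congr 1; ring
      _ = ∑ t ∈ S, ∑ s ∈ S, ∑ c, φ (c * (t - s)) := by
          rw [Finset.sum_comm]
          exact Finset.sum_congr rfl fun t _ => Finset.sum_comm
      _ = ∑ t ∈ S, (Fintype.card F : ℂ) := by
          refine Finset.sum_congr rfl fun t ht => ?_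
          simp_rw [hφ, sub_eq_zero]
          rw [Finset.sum_ite_eq, if_pos ht]
      _ = _ := by simp [mul_comm]
  exact_mod_cast this

theorem prod_norm_le {F : Type*} [Field F] [Fintype F] [DecidableEq F] (φ : AddChar F ℂ)
    (h2 : 2 < Fintype.card F)
    (hφ : ∀ b, ∑ x, φ (x * b) = if b = 0 then (Fintype.card F : ℂ) else 0) (S : Finset F) :
    ‖∏ c ∈ univ.erase 0, ∑ t ∈ S, φ (c * t)‖ ≤
      (((Fintype.card F : ℝ) - S.card) * S.card) ^ (((Fintype.card F : ℝ) - 1) / 2) /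
        ((Fintype.card F : ℝ) - 1) ^ (((Fintype.card F : ℝ) - 1) / 2) := by
  have hq : (2 : ℝ) < Fintype.card F := by exact_mod_cast h2
  have hS : (S.card : ℝ) ≤ Fintype.card F := by exact_mod_cast S.card_le_univ
  have hnorm := sum_normSq_eq φ hφ S
  have hcard : ((univ.erase (0 : F)).card : ℝ) = (Fintype.card F : ℝ) - 1 := by
    rw [Finset.card_erase_of_mem (Finset.mem_univ _), Finset.card_univ, Nat.cast_sub (by omega)]
    simp
  set q : ℝ := (Fintype.card F : ℝ) with hqdef
  have hsum : ∑ c ∈ univ.erase 0, ‖∑ t ∈ S, φ (c * t)‖ ^ 2 = (q - S.card) * S.card := by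
    rw [← Finset.add_sum_erase _ _ (Finset.mem_univ (0 : F))] at hnorm
    simp only [zero_mul, AddChar.map_zero_eq_one, Finset.sum_const, nsmul_eq_mul, mul_one,
      Complex.norm_natCast] at hnorm
    linarith
  have hamgm := Real.geom_mean_le_arith_mean_weighted (univ.erase (0 : F)) (fun _ => 1 / (q - 1))
    (fun c => ‖∑ t ∈ S, φ (c * t)‖ ^ 2)
    (fun _ _ => by apply div_nonneg zero_le_one; linarith)
    (by rw [Finset.sum_const, nsmul_eq_mul, hcard]; field_simp [show q - 1 ≠ 0 by linarith])
    (fun _ _ => by positivity)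
  rw [← Finset.mul_sum, hsum, Real.finsetProd_rpow _ _ (fun _ _ => by positivity),
    Finset.prod_pow, ← norm_prod] at hamgm
  set P := ‖∏ c ∈ univ.erase 0, ∑ t ∈ S, φ (c * t)‖ with hP
  have hP0 : 0 ≤ P := norm_nonneg _
  have h := Real.rpow_le_rpow (by positivity) hamgm (show 0 ≤ (q - 1) / 2 by linarith)
  rw [← Real.rpow_natCast, ← Real.rpow_mul hP0, ← Real.rpow_mul hP0,
    show ((2 : ℕ) : ℝ) * (1 / (q - 1)) * ((q - 1) / 2) = 1 by
      have : q - 1 ≠ 0 := by linarith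
      push_cast; field_simp, Real.rpow_one] at h
  rw [← Real.div_rpow (mul_nonneg (by linarith) (by positivity)) (by linarith)]
  convert h using 2
  ring

theorem per_bound {F : Type*} [Field F] [Fintype F] [DecidableEq F] (φ : AddChar F ℂ)
    (h2 : 2 < Fintype.card F)
    (hφ : ∀ b, ∑ x, φ (x * b) = if b = 0 then (Fintype.card F : ℂ) else 0) :
    ‖∑ σ : Equiv.Perm F, φ (∑ c, c * σ c)‖ ≤
      1 / (2 * ((Fintype.card F : ℝ) - 1) ^ (((Fintype.card F : ℝ) - 1) / 2)) *
      ∑ S : Finset F, |(Fintype.card F : ℝ) - 2 * S.card| *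
      (((Fintype.card F : ℝ) - S.card) * S.card) ^ (((Fintype.card F : ℝ) - 1) / 2) := by
  set P : Finset F → ℂ := fun S => ∏ c ∈ univ.erase 0, ∑ t ∈ S, φ (c * t) with hP
  obtain ⟨n, hn⟩ : ∃ n, Fintype.card F = n + 1 := ⟨Fintype.card F - 1, by omega⟩
  have hprod : ∀ S : Finset F, ∏ c, ∑ t ∈ S, φ (c * t) = S.card * P S := by
    intro S
    rw [← Finset.mul_prod_erase _ _ (Finset.mem_univ (0 : F))]
    simp [hP]
  have hcompl : ∀ S : Finset F, P Sᶜ = (-1) ^ n * P S := by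
    intro S
    have hc : (univ.erase (0 : F)).card = n := by
      rw [Finset.card_erase_of_mem (Finset.mem_univ _), Finset.card_univ, hn]; rfl
    simp only [hP]
    rw [← hc, ← Finset.prod_const, ← Finset.prod_mul_distrib]
    refine Finset.prod_congr rfl fun c hc => ?_
    have h0 := hφ c
    rw [if_neg (Finset.ne_of_mem_erase hc), ← Finset.sum_add_sum_compl S] at h0
    simp_rw [mul_comm _ c] at h0
    linear_combination h0
  have hper : ∑ σ : Equiv.Perm F, φ (∑ c, c * σ c) =
      (-1) ^ (n + 1) * ∑ S : Finset F, (-1) ^ S.card * (S.card * P S) := by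
    rw [← hn]
    simp_rw [← hprod]
    rw [← ryser (fun c t => φ (c * t))]
    exact Finset.sum_congr rfl fun σ _ => map_prod φ.toMonoidHom _ _
  have hflip : ∑ S : Finset F, (-1 : ℂ) ^ S.card * (S.card * P S) =
      ∑ S : Finset F, -((-1 : ℂ) ^ S.card * (((Fintype.card F : ℂ) - S.card) * P S)) := by
    rw [← Equiv.sum_comp (compl_involutive (α := Finset F)).toPerm]
    refine Finset.sum_congr rfl fun S _ => ?_
    simp only [Function.Involutive.coe_toPerm]
    rw [hcompl, Finset.card_compl, Nat.cast_sub S.card_le_univ]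
    have hle : S.card ≤ n + 1 := hn ▸ S.card_le_univ
    have : (-1 : ℂ) ^ (Fintype.card F - S.card) * (-1) ^ n = -(-1) ^ S.card := by
      rw [hn]
      obtain ⟨m, hm⟩ := Nat.exists_eq_add_of_le hle
      rw [hm, Nat.add_sub_cancel_left, ← pow_add,
        show -(-1 : ℂ) ^ S.card = (-1) ^ (S.card + 1) by ring]
      have : m + n + 1 = 2 * m + S.card := by omega
      have h3 : (-1 : ℂ) ^ (m + n + 1) = (-1) ^ S.card := by
        rw [this, pow_add, pow_mul]; simp
      rw [pow_succ] at h3 ⊢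
      linear_combination -h3
    linear_combination ((Fintype.card F : ℂ) - S.card) * P S * this
  have hhalf : ∑ S : Finset F, (-1 : ℂ) ^ S.card * (S.card * P S) =
      1 / 2 * ∑ S : Finset F, (-1 : ℂ) ^ S.card * (-((Fintype.card F : ℂ) - 2 * S.card) * P S) := by
    have : ∑ S : Finset F, (-1 : ℂ) ^ S.card * (-((Fintype.card F : ℂ) - 2 * S.card) * P S) =
        ∑ S : Finset F, (-1 : ℂ) ^ S.card * (S.card * P S) +
        ∑ S : Finset F, -((-1 : ℂ) ^ S.card * (((Fintype.card F : ℂ) - S.card) * P S)) := by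
      rw [← Finset.sum_add_distrib]
      exact Finset.sum_congr rfl fun S _ => by ring
    rw [this, ← hflip]; ring
  rw [hper, hhalf, norm_mul, norm_pow, norm_neg, norm_one, one_pow, one_mul, norm_mul]
  have hb : ‖∑ S : Finset F, (-1 : ℂ) ^ S.card * (-((Fintype.card F : ℂ) - 2 * S.card) * P S)‖ ≤
      ∑ S : Finset F, |(Fintype.card F : ℝ) - 2 * S.card| *
      ((((Fintype.card F : ℝ) - S.card) * S.card) ^ (((Fintype.card F : ℝ) - 1) / 2) /
        ((Fintype.card F : ℝ) - 1) ^ (((Fintype.card F : ℝ) - 1) / 2)) := by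
    refine (norm_sum_le _ _).trans (Finset.sum_le_sum fun S _ => ?_)
    rw [norm_mul, norm_pow, norm_neg, norm_one, one_pow, one_mul, norm_mul, norm_neg]
    have : ‖(Fintype.card F : ℂ) - 2 * S.card‖ = |(Fintype.card F : ℝ) - 2 * S.card| := by
      rw [← Real.norm_eq_abs, ← Complex.norm_real]; push_cast; rfl
    rw [this]
    exact mul_le_mul_of_nonneg_left (prod_norm_le φ h2 hφ S) (abs_nonneg _)
  have hhn : ‖(1 / 2 : ℂ)‖ = 1 / 2 := by norm_num
  rw [hhn]
  refine (mul_le_mul_of_nonneg_left hb (by norm_num)).trans (le_of_eq ?_)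
  rw [Finset.mul_sum, Finset.mul_sum]
  refine Finset.sum_congr rfl fun S _ => ?_
  rw [← div_div]
  ring

theorem abs_N_sub_factorial_le_sum' (F : Type*) [Field F] [Fintype F] [DecidableEq F]
    (q : ℕ) (hq : q = Fintype.card F) (hq2 : 2 < q)
    (N : ℕ)
    (hN : N = Nat.card {σ : Equiv.Perm F // (permPoly σ).degree < ((q - 2 : ℕ) : WithBot ℕ)}) :
    |(N : ℝ) - ((q - 1).factorial : ℝ)| ≤
      ((q : ℝ) - 1) / (2 * q * ((q : ℝ) - 1) ^ (((q : ℝ) - 1) / 2)) *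
        ∑ S : Finset F, |(q : ℝ) - 2 * S.card| *
          (((q : ℝ) - S.card) * S.card) ^ (((q : ℝ) - 1) / 2) := by
  subst hq
  have hN' : N = (univ.filter fun σ : Equiv.Perm F => ∑ c, c * σ c = 0).card := by
    rw [hN, Nat.card_congr (Equiv.subtypeEquivRight (degree_iff hq2)), Nat.card_eq_fintype_card,
      Fintype.card_subtype]
  let ψ : AddChar F ℂ := AddChar.FiniteField.primitiveChar_to_Complex F
  have hψ : ψ.IsPrimitive := AddChar.FiniteField.primitiveChar_to_Complex_isPrimitive F
  have horth : ∀ b : F, ∑ x, ψ (x * b) = if b = 0 then (Fintype.card F : ℂ) else 0 := by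
    intro b
    rw [AddChar.sum_mulShift b hψ]
    split_ifs <;> simp
  have hqN : (Fintype.card F : ℂ) * N = ∑ a : F, ∑ σ : Equiv.Perm F, ψ (a * ∑ c, c * σ c) := by
    rw [Finset.sum_comm]
    simp_rw [horth]
    rw [← Finset.sum_filter, Finset.sum_const, nsmul_eq_mul, hN', mul_comm]
  set B : ℝ := 1 / (2 * ((Fintype.card F : ℝ) - 1) ^ (((Fintype.card F : ℝ) - 1) / 2)) *
      ∑ S : Finset F, |(Fintype.card F : ℝ) - 2 * S.card| *
      (((Fintype.card F : ℝ) - S.card) * S.card) ^ (((Fintype.card F : ℝ) - 1) / 2) with hB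
  have hbound : ∀ a : F, a ≠ 0 → ‖∑ σ : Equiv.Perm F, ψ (a * ∑ c, c * σ c)‖ ≤ B := by
    intro a ha
    have := per_bound (ψ.mulShift a) hq2 (by
      intro b
      simp_rw [AddChar.mulShift_apply]
      have := horth (a * b)
      simp only [mul_eq_zero, ha, false_or] at this
      rw [← this]
      exact Finset.sum_congr rfl fun x _ => by congr 1; ring)
    simpa only [AddChar.mulShift_apply] using this
  have hfac : (Fintype.card F : ℂ) * ((Fintype.card F - 1).factorial : ℂ) =
      ((Fintype.card F).factorial : ℂ) := by
    exact_mod_cast Nat.mul_factorial_pred (by omega)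
  have hdiff : (Fintype.card F : ℂ) * ((N : ℂ) - ((Fintype.card F - 1).factorial : ℂ)) =
      ∑ a ∈ univ.erase (0 : F), ∑ σ : Equiv.Perm F, ψ (a * ∑ c, c * σ c) := by
    rw [mul_sub, hqN, hfac, ← Finset.add_sum_erase _ _ (Finset.mem_univ (0 : F))]
    simp [Fintype.card_perm]
  have hq0 : (2 : ℝ) < Fintype.card F := by exact_mod_cast hq2
  have hle : (Fintype.card F : ℝ) * |(N : ℝ) - ((Fintype.card F - 1).factorial : ℝ)| ≤
      ((Fintype.card F : ℝ) - 1) * B := by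
    have e : (Fintype.card F : ℝ) * |(N : ℝ) - ((Fintype.card F - 1).factorial : ℝ)| =
        ‖(Fintype.card F : ℂ) * ((N : ℂ) - ((Fintype.card F - 1).factorial : ℂ))‖ := by
      rw [norm_mul, Complex.norm_natCast, ← Real.norm_eq_abs, ← Complex.norm_real]
      push_cast; rfl
    rw [e, hdiff]
    refine (norm_sum_le_of_le _ (fun a ha => hbound a (Finset.ne_of_mem_erase ha))).trans
      (le_of_eq ?_)
    rw [Finset.sum_const, nsmul_eq_mul, Finset.card_erase_of_mem (Finset.mem_univ _),
      Finset.card_univ, Nat.cast_sub (by omega)]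
    simp
  rw [mul_comm, ← le_div_iff₀ (by linarith)] at hle
  refine hle.trans (le_of_eq ?_)
  rw [hB, ← mul_assoc, mul_div_right_comm]
  congr 1
  rw [mul_one_div, div_div]
  congr 1
  ring
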